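/- Let $N\ge3$ and let $\rho\in C^1([0,\infty))$ satisfy $\rho(0)=1$ and condition $(\rho_1)$: there exists $c_1>0$ with $0<\rho'(s)s\le c_1\rho(s)$ for all $s>0$. Let $f,g:\mathbb{R}\to\mathbb{R}$ be continuous and set $F(t)=\int_0^t f(s)\,ds$, $G(t)=\int_0^t g(s)\,ds$. Suppose $u:\overline{\mathbb{R}^N_+}\to\mathbb{R}$ is twice continuously differentiable up to the boundary (i.e. $u$ and its first- and second-order partial derivatives are continuous on $\overline{\mathbb{R}^N_+}$) and satisfies $-\mathrm{div}(\rho(x_N)\nabla u)=f(u)$ pointwise in $\mathbb{R}^N_+$ and $-\frac{\partial u}{\partial x_N}(x',0)=g(u(x',0))$ for all $x'\in\mathbb{R}^{N-1}$. If $\rho(x_N)|\nabla u|^2\in L^1(\mathbb{R}^N_+)$, $F(u)\in L^1(\mathbb{R}^N_+)$ and $G(u(\cdot,0))\in L^1(\mathbb{R}^{N-1})$, then the Pohozaev identity holds: $\frac{N-2}{2}\int_{\mathbb{R}^N_+}\rho(x_N)|\nabla u|^2\,dx+\frac{1}{2}\int_{\mathbb{R}^N_+}\rho'(x_N)\,x_N\,|\nabla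 u|^2\,dx=N\int_{\mathbb{R}^N_+}F(u)\,dx+(N-1)\int_{\mathbb{R}^{N-1}}G(u(x',0))\,dx'$. -/

import Mathlib

open MeasureTheory Filter
open scoped Topology ENNReal

noncomputable section

/-- The last coordinate of a point of `ℝ^N`. -/
def xN (N : ℕ) (hN : 0 < N) (x : EuclideanSpace ℝ (Fin N)) : ℝ :=
  x ⟨N - 1, Nat.sub_lt hN Nat.one_pos⟩

/-- The open upper half-space `ℝ^N₊`. -/
def Hplus (N : ℕ) (hN : 0 < N) : Set (EuclideanSpace ℝ (Fin N)) :=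
  {x | 0 < xN N hN x}

/-- The point `(y, t) ∈ ℝ^N` with horizontal part `y ∈ ℝ^(N-1)` and last coordinate `t`. -/
def mkPt (N : ℕ) (y : EuclideanSpace ℝ (Fin (N - 1))) (t : ℝ) :
    EuclideanSpace ℝ (Fin N) :=
  (WithLp.equiv 2 (Fin N → ℝ)).symm fun i => if h : (i : ℕ) < N - 1 then y ⟨(i : ℕ), h⟩ else t

/-- The boundary point `(y, 0)`. -/
def bPt (N : ℕ) (y : EuclideanSpace ℝ (Fin (N - 1))) : EuclideanSpace ℝ (Fin N) :=
  mkPt N y 0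

/-- Partial derivative of `u` in the `i`-th coordinate direction. -/
def pd (N : ℕ) (u : EuclideanSpace ℝ (Fin N) → ℝ) (i : Fin N)
    (x : EuclideanSpace ℝ (Fin N)) : ℝ :=
  fderiv ℝ u x (EuclideanSpace.single i 1)

/-- `div (w ∇u)` written as a sum of coordinate partial derivatives. -/
def divW (N : ℕ) (w u : EuclideanSpace ℝ (Fin N) → ℝ)
    (x : EuclideanSpace ℝ (Fin N)) : ℝ :=
  ∑ i, pd N (fun z => w z * pd N u i z) i x

lemma int_fderiv_zero {E : Type*} [NormedAddCommGroup E] [NormedSpace ℝ E] [FiniteDimensional ℝ E]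
    [MeasurableSpace E] [BorelSpace E] (μ : Measure E) [μ.IsAddHaarMeasure]
    (h : E → ℝ) (hh : ContDiff ℝ 1 h) (hc : HasCompactSupport h) (v : E) :
    ∫ y, fderiv ℝ h y v ∂μ = 0 := by
  have hi : Integrable (fun y => fderiv ℝ h y v) μ := by
    apply Continuous.integrable_of_hasCompactSupport
    · have := hh.continuous_fderiv (by norm_num)
      fun_prop
    · exact hc.fderiv_apply ℝ v
  have := integral_mul_fderiv_eq_neg_fderiv_mul_of_integrable (𝕜 := ℝ) (μ := μ)
    (f := fun _ : E => (1:ℝ)) (g := h) (v := v) (by simp) (by simpa using hi)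
    (by simpa using hh.continuous.integrable_of_hasCompactSupport hc)
    (fun x _ => by fun_prop) (fun x _ => (hh.differentiable (by norm_num)) x)
  simpa using this

lemma mkPt_eq (n : ℕ) (y : EuclideanSpace ℝ (Fin n)) (t : ℝ) :
    mkPt (n+1) y t = WithLp.toLp 2 ((Fin.last n).insertNth t (WithLp.ofLp y) : Fin (n+1) → ℝ) := by
  ext i
  refine Fin.lastCases ?_ (fun j => ?_) i
  · simp [mkPt]
  · simp [mkPt]

lemma abs_coord_le {n : ℕ} (x : EuclideanSpace ℝ (Fin n)) (i : Fin n) : |x i| ≤ ‖x‖ := by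
  simpa using PiLp.norm_apply_le x i

lemma half_div (n : ℕ) (W : Fin (n+1) → EuclideanSpace ℝ (Fin (n+1)) → ℝ)
    (hW : ∀ i, ContDiff ℝ 1 (W i)) (hc : ∀ i, HasCompactSupport (W i)) :
    ∫ x in Hplus (n+1) (Nat.succ_pos n), ∑ i, pd (n+1) (W i) i x =
      - ∫ y : EuclideanSpace ℝ (Fin n), W (Fin.last n) (mkPt (n+1) y 0) := by
  obtain ⟨M, hM⟩ : ∃ M : ℝ, ∀ i x, M ≤ ‖x‖ → W i x = 0 ∧ fderiv ℝ (W i) x = 0 := by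
    have h1 : ∀ i, ∃ M : ℝ, ∀ x, M ≤ ‖x‖ → W i x = 0 ∧ fderiv ℝ (W i) x = 0 := by
      intro i
      obtain ⟨M, hM⟩ := (hc i).isCompact.isBounded.exists_norm_le
      refine ⟨M + 1, fun x hx => ?_⟩
      have hx' : x ∉ tsupport (W i) := fun h => by linarith [hM x h]
      refine ⟨image_eq_zero_of_notMem_tsupport hx', ?_⟩
      have : x ∉ tsupport (fderiv ℝ (W i)) := fun h => hx' (tsupport_fderiv_subset ℝ h)
      exact image_eq_zero_of_notMem_tsupport this
    choose M hM using h1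
    refine ⟨∑ i, |M i|, fun i x hx => hM i x (le_trans ?_ hx)⟩
    exact (le_abs_self _).trans (Finset.single_le_sum (f := fun i => |M i|)
      (fun j _ => abs_nonneg _) (Finset.mem_univ i))
  set R : ℝ := |M| + 1 with hR
  have hRpos : 0 < R := by positivity
  have hMR : M ≤ R := by linarith [le_abs_self M]
  have hco : ∀ (z : Fin (n+1) → ℝ) j, R ≤ |z j| → M ≤ ‖WithLp.toLp 2 z‖ := by
    intro z j hj
    have := abs_coord_le (WithLp.toLp 2 z) j
    simp only at this
    linarith
  let e : EuclideanSpace ℝ (Fin (n+1)) ≃L[ℝ] (Fin (n+1) → ℝ) := EuclideanSpace.equiv (Fin (n+1)) ℝ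
  let a : Fin (n+1) → ℝ := (Fin.last n).insertNth 0 (fun _ => -R)
  let b : Fin (n+1) → ℝ := fun _ => R
  have ha_last : a (Fin.last n) = 0 := by simp [a]
  have ha_cs : ∀ j : Fin n, a j.castSucc = -R := by intro j; simp [a]
  have hab : a ≤ b := by
    intro i
    refine Fin.lastCases ?_ (fun j => ?_) i
    · rw [ha_last]; exact hRpos.le
    · rw [ha_cs]; simp only [b]; linarith
  let G : EuclideanSpace ℝ (Fin (n+1)) → ℝ := fun x => ∑ i, pd (n+1) (W i) i x
  have hGc : Continuous G := by
    apply continuous_finsetSum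
    intro i _
    have := (hW i).continuous_fderiv (by norm_num)
    unfold pd
    fun_prop
  have hcont_toLp : Continuous (fun z : Fin (n+1) → ℝ => (WithLp.toLp 2 z : EuclideanSpace ℝ (Fin (n+1)))) := by
    fun_prop
  have hfd : ∀ i (z : Fin (n+1) → ℝ), HasFDerivAt (fun z : Fin (n+1) → ℝ => W i (WithLp.toLp 2 z))
      ((fderiv ℝ (W i) (WithLp.toLp 2 z)).comp (e.symm : (Fin (n+1) → ℝ) →L[ℝ] _)) z := by
    intro i z
    have h1 : HasFDerivAt (W i) (fderiv ℝ (W i) (e.symm z)) (e.symm z) :=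
      ((hW i).differentiable (by norm_num) _).hasFDerivAt
    exact h1.comp z e.symm.hasFDerivAt
  have hes : ∀ i, e.symm (Pi.single i 1) = EuclideanSpace.single i 1 := by
    intro i; rfl
  have key := integral_divergence_of_hasFDerivAt_off_countable' a b hab
    (fun i z => W i (WithLp.toLp 2 z))
    (fun i z => (fderiv ℝ (W i) (WithLp.toLp 2 z)).comp (e.symm : (Fin (n+1) → ℝ) →L[ℝ] _))
    ∅ Set.countable_empty
    (fun i => ((hW i).continuous.comp hcont_toLp).continuousOn)
    (fun z _ i => hfd i z)
    (by
      apply Continuous.integrableOn_Icc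
      exact hGc.comp hcont_toLp)
  have hL : (∫ x in Hplus (n+1) (Nat.succ_pos n), G x) =
      ∫ z in Set.Icc a b, G (WithLp.toLp 2 z) := by
    have h1 := (PiLp.volume_preserving_toLp (Fin (n+1))).setIntegral_preimage_emb
      (MeasurableEquiv.toLp 2 (Fin (n+1) → ℝ)).measurableEmbedding G (Hplus (n+1) (Nat.succ_pos n))
    rw [← h1]
    have h2 : (WithLp.toLp 2 ⁻¹' Hplus (n+1) (Nat.succ_pos n) : Set (Fin (n+1) → ℝ)) =ᵐ[volume]
        {z : Fin (n+1) → ℝ | 0 ≤ z (Fin.last n)} := by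
      have := Measure.ae_eval_ne (μ := fun _ : Fin (n+1) => (volume : Measure ℝ)) (Fin.last n) 0
      rw [← volume_pi] at this
      filter_upwards [this] with z hz
      apply propext
      change 0 < z (Fin.last n) ↔ 0 ≤ z (Fin.last n)
      exact ⟨le_of_lt, fun h => lt_of_le_of_ne h (Ne.symm hz)⟩
    rw [setIntegral_congr_set h2]
    apply setIntegral_eq_of_subset_of_forall_sdiff_eq_zero
    · exact measurableSet_le measurable_const (measurable_pi_apply _)
    · intro z hz
      have := hz.1 (Fin.last n)
      rwa [ha_last] at this
    · rintro z ⟨hz0, hz⟩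
      have : ∃ j, R ≤ |z j| := by
        by_contra hcon
        push Not at hcon
        apply hz
        refine ⟨fun i => ?_, fun i => (abs_lt.1 (hcon i)).2.le⟩
        refine Fin.lastCases ?_ (fun j => ?_) i
        · rw [ha_last]; exact hz0
        · rw [ha_cs]; exact (abs_lt.1 (hcon _)).1.le
      obtain ⟨j, hj⟩ := this
      apply Finset.sum_eq_zero
      intro i _
      simp [pd, (hM i _ (hco z j hj)).2]
  change (∫ x in Hplus (n+1) (Nat.succ_pos n), G x) = _
  rw [hL]
  change (∫ z in Set.Icc a b, G (WithLp.toLp 2 z)) = _ at key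
  rw [key, Fin.sum_univ_castSucc, Finset.sum_eq_zero, zero_add]
  · rw [setIntegral_eq_zero_of_forall_eq_zero, zero_sub]
    · congr 1
      rw [setIntegral_eq_integral_of_forall_compl_eq_zero]
      · have h1 := (PiLp.volume_preserving_ofLp (Fin n)).integral_comp
          (MeasurableEquiv.toLp 2 (Fin n → ℝ)).symm.measurableEmbedding
          (fun z => W (Fin.last n) (WithLp.toLp 2 ((Fin.last n).insertNth (a (Fin.last n)) z)))
        rw [← h1]
        congr 1
        ext y
        rw [mkPt_eq, ha_last]
      · intro z hz
        have : ∃ j, R ≤ |z j| := by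
          by_contra hcon
          push Not at hcon
          apply hz
          refine ⟨fun i => ?_, fun i => (abs_lt.1 (hcon i)).2.le⟩
          simp only [Function.comp, Fin.succAbove_last, ha_cs]
          exact (abs_lt.1 (hcon _)).1.le
        obtain ⟨j, hj⟩ := this
        apply (hM _ _ (hco _ j.castSucc _)).1
        simpa using hj
    · intro z _
      apply (hM _ _ (hco _ (Fin.last n) _)).1
      simpa [b] using le_abs_self R
  · intro i _
    rw [setIntegral_eq_zero_of_forall_eq_zero, setIntegral_eq_zero_of_forall_eq_zero, sub_zero]
    · intro z _
      apply (hM _ _ (hco _ i.castSucc _)).1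
      rw [Fin.insertNth_apply_same, ha_cs, abs_neg]
      exact le_abs_self R
    · intro z _
      apply (hM _ _ (hco _ i.castSucc _)).1
      rw [Fin.insertNth_apply_same]
      exact le_abs_self R

section calculus
variable {N : ℕ}

lemma sum_pd (h : EuclideanSpace ℝ (Fin N) → ℝ) (x v : EuclideanSpace ℝ (Fin N)) :
    ∑ i, v i * pd N h i x = fderiv ℝ h x v := by
  have hv : v = ∑ i, v i • EuclideanSpace.single i (1:ℝ) := by
    ext j
    simp [Pi.single_apply]
  conv_rhs => rw [hv]
  simp [pd]

lemma grad_coord (u : EuclideanSpace ℝ (Fin N) → ℝ) (x : EuclideanSpace ℝ (Fin N)) (i : Fin N) :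
    (gradient u x) i = pd N u i x := by
  have h : inner ℝ (gradient u x) (EuclideanSpace.single i (1:ℝ)) = pd N u i x := by
    simp [gradient, pd]
  rw [← h, EuclideanSpace.inner_single_right]
  simp

lemma grad_sq (u : EuclideanSpace ℝ (Fin N) → ℝ) (x : EuclideanSpace ℝ (Fin N)) :
    ‖gradient u x‖ ^ 2 = ∑ i, pd N u i x * pd N u i x := by
  rw [EuclideanSpace.norm_sq_eq]
  apply Finset.sum_congr rfl
  intro i _
  rw [grad_coord, Real.norm_eq_abs, sq_abs, sq]

lemma pd_mul {a b : EuclideanSpace ℝ (Fin N) → ℝ} (ha : ContDiff ℝ 1 a) (hb : ContDiff ℝ 1 b)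
    (i : Fin N) (x : EuclideanSpace ℝ (Fin N)) :
    pd N (fun z => a z * b z) i x = a x * pd N b i x + pd N a i x * b x := by
  unfold pd
  rw [fderiv_fun_mul (ha.differentiable (by norm_num) x) (hb.differentiable (by norm_num) x)]
  simp; ring

lemma pd_add {a b : EuclideanSpace ℝ (Fin N) → ℝ} (ha : ContDiff ℝ 1 a) (hb : ContDiff ℝ 1 b)
    (i : Fin N) (x : EuclideanSpace ℝ (Fin N)) :
    pd N (fun z => a z + b z) i x = pd N a i x + pd N b i x := by
  unfold pd
  rw [fderiv_fun_add (ha.differentiable (by norm_num) x) (hb.differentiable (by norm_num) x)]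
  simp

lemma pd_sum {a : Fin N → EuclideanSpace ℝ (Fin N) → ℝ} (ha : ∀ j, ContDiff ℝ 1 (a j))
    (i : Fin N) (x : EuclideanSpace ℝ (Fin N)) :
    pd N (fun z => ∑ j, a j z) i x = ∑ j, pd N (a j) i x := by
  unfold pd
  rw [fderiv_fun_sum (fun j _ => (ha j).differentiable (by norm_num) x)]
  simp

lemma contDiff_coord (j : Fin N) :
    ContDiff ℝ 1 (fun z : EuclideanSpace ℝ (Fin N) => z j) := by
  fun_prop

lemma pd_coord (i j : Fin N) (x : EuclideanSpace ℝ (Fin N)) :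
    pd N (fun z => z j) i x = if j = i then 1 else 0 := by
  unfold pd
  have : HasFDerivAt (fun z : EuclideanSpace ℝ (Fin N) => z j)
      (EuclideanSpace.proj j : EuclideanSpace ℝ (Fin N) →L[ℝ] ℝ) x :=
    (EuclideanSpace.proj j : EuclideanSpace ℝ (Fin N) →L[ℝ] ℝ).hasFDerivAt
  rw [this.fderiv]
  simp

lemma contDiff_pd {u : EuclideanSpace ℝ (Fin N) → ℝ} (hu : ContDiff ℝ 2 u) (i : Fin N) :
    ContDiff ℝ 1 (pd N u i) := by
  unfold pd
  have := hu.fderiv_right (m := 1) (by norm_num)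
  fun_prop

lemma pd_symm {u : EuclideanSpace ℝ (Fin N) → ℝ} (hu : ContDiff ℝ 2 u) (i j : Fin N)
    (x : EuclideanSpace ℝ (Fin N)) : pd N (pd N u i) j x = pd N (pd N u j) i x := by
  have h1 : IsSymmSndFDerivAt ℝ u x := hu.contDiffAt.isSymmSndFDerivAt (by simp)
  have hd : DifferentiableAt ℝ (fderiv ℝ u) x :=
    (hu.fderiv_right (m := 1) (by norm_num)).differentiable (by norm_num) x
  have h2 : ∀ i j, pd N (pd N u i) j x =
      fderiv ℝ (fderiv ℝ u) x (EuclideanSpace.single j 1) (EuclideanSpace.single i 1) := by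
    intro i j
    unfold pd
    rw [fderiv_clm_apply hd (by fun_prop)]
    simp
  rw [h2, h2]
  exact h1.eq _ _

lemma div_radial {K : EuclideanSpace ℝ (Fin N) → ℝ} (hK : ContDiff ℝ 1 K)
    (x : EuclideanSpace ℝ (Fin N)) :
    ∑ i, pd N (fun z => K z * z i) i x = N * K x + fderiv ℝ K x x := by
  rw [← sum_pd]
  simp_rw [pd_mul hK (contDiff_coord _), pd_coord]
  simp [Finset.sum_add_distrib, mul_comm]

lemma divV {u w Φ : EuclideanSpace ℝ (Fin N) → ℝ} (hu : ContDiff ℝ 2 u) (hw : ContDiff ℝ 1 w)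
    (hΦ : ContDiff ℝ 1 Φ) (x : EuclideanSpace ℝ (Fin N)) (c : ℝ)
    (hc : fderiv ℝ Φ x x = c * fderiv ℝ u x x) (hpde : -divW N w u x = c) :
    ∑ i, pd N (fun z => (∑ j, z j * pd N u j z) * (w z * pd N u i z) +
      (Φ z + (-1/2) * (w z * ∑ j, pd N u j z * pd N u j z)) * z i) i x =
    (1 - (N:ℝ)/2) * (w x * ‖gradient u x‖ ^ 2) - 1/2 * (fderiv ℝ w x x * ‖gradient u x‖^2)
      + N * Φ x := by
  have hP := contDiff_pd hu
  have hS : ContDiff ℝ 1 (fun z : EuclideanSpace ℝ (Fin N) => ∑ j, z j * pd N u j z) :=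
    ContDiff.sum fun j _ => (contDiff_coord j).mul (hP j)
  have hQ : ContDiff ℝ 1 (fun z : EuclideanSpace ℝ (Fin N) => ∑ j, pd N u j z * pd N u j z) :=
    ContDiff.sum fun j _ => (hP j).mul (hP j)
  have hwQ : ContDiff ℝ 1 (fun z : EuclideanSpace ℝ (Fin N) =>
      (-1/2) * (w z * ∑ j, pd N u j z * pd N u j z)) := contDiff_const.mul (hw.mul hQ)
  have hK : ContDiff ℝ 1 (fun z : EuclideanSpace ℝ (Fin N) =>
      Φ z + (-1/2) * (w z * ∑ j, pd N u j z * pd N u j z)) := hΦ.add hwQ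
  have e1 : ∀ i, pd N (fun z => (∑ j, z j * pd N u j z) * (w z * pd N u i z) +
      (Φ z + (-1/2) * (w z * ∑ j, pd N u j z * pd N u j z)) * z i) i x =
      ((∑ j, x j * pd N u j x) * pd N (fun z => w z * pd N u i z) i x +
        (pd N u i x + ∑ j, x j * pd N (pd N u j) i x) * (w x * pd N u i x)) +
      pd N (fun z => (Φ z + (-1/2) * (w z * ∑ j, pd N u j z * pd N u j z)) * z i) i x := by
    intro i
    rw [pd_add (hS.mul (hw.mul (hP i))) (hK.mul (contDiff_coord i)), pd_mul hS (hw.mul (hP i)),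
      pd_sum (fun j => (contDiff_coord j).mul (hP j))]
    congr 3
    simp_rw [pd_mul (contDiff_coord _) (hP _), pd_coord]
    simp [Finset.sum_add_distrib, add_comm]
  have e2 : fderiv ℝ (fun z => Φ z + (-1/2) * (w z * ∑ j, pd N u j z * pd N u j z)) x x =
      c * fderiv ℝ u x x - 1/2 * (fderiv ℝ w x x * (∑ j, pd N u j x * pd N u j x))
        - w x * ∑ i, ∑ j, x i * (pd N u j x * pd N (pd N u j) i x) := by
    rw [← hc, ← sum_pd, ← sum_pd, ← sum_pd]
    have : ∀ i, pd N (fun z => Φ z + (-1/2) * (w z * ∑ j, pd N u j z * pd N u j z)) i x =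
        pd N Φ i x + (-1/2) * (w x * (∑ j, 2 * (pd N u j x * pd N (pd N u j) i x)) +
          pd N w i x * ∑ j, pd N u j x * pd N u j x) := by
      intro i
      rw [pd_add hΦ hwQ, pd_mul contDiff_const (hw.mul hQ), pd_mul hw hQ,
        pd_sum (fun j => (hP j).mul (hP j))]
      simp_rw [pd_mul (hP _) (hP _)]
      have : pd N (fun _ => (-1/2 : ℝ)) i x = 0 := by simp [pd]
      rw [this, zero_mul, add_zero]
      congr 5
      ext j
      ring
    simp_rw [this, ← Finset.mul_sum]
    rw [Finset.sum_mul, Finset.mul_sum, Finset.mul_sum, ← Finset.sum_sub_distrib,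
      ← Finset.sum_sub_distrib]
    apply Finset.sum_congr rfl
    intro i _
    ring
  simp_rw [e1]
  rw [Finset.sum_add_distrib, div_radial hK, e2, Finset.sum_add_distrib, ← Finset.mul_sum,
    grad_sq]
  have e3 : ∑ i, pd N (fun z => w z * pd N u i z) i x = - c := by
    rw [← hpde]; simp [divW]
  have e4 : ∑ i, (pd N u i x + ∑ j, x j * pd N (pd N u j) i x) * (w x * pd N u i x) =
      w x * (∑ j, pd N u j x * pd N u j x) +
        w x * ∑ i, ∑ j, x i * (pd N u j x * pd N (pd N u j) i x) := by
    rw [Finset.sum_comm (f := fun i j => x i * (pd N u j x * pd N (pd N u j) i x)),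
      ← mul_add, ← Finset.sum_add_distrib, Finset.mul_sum]
    apply Finset.sum_congr rfl
    intro i _
    have : ∑ j, x j * (pd N u i x * pd N (pd N u i) j x) =
        pd N u i x * ∑ j, x j * pd N (pd N u j) i x := by
      rw [Finset.mul_sum]
      apply Finset.sum_congr rfl
      intro j _
      rw [pd_symm hu i j]; ring
    rw [this]; ring
  rw [e3, e4, sum_pd]
  ring

end calculus

lemma exists_cutoff (N : ℕ) : ∃ χ : ℕ → EuclideanSpace ℝ (Fin N) → ℝ,
    (∀ k, ContDiff ℝ 1 (χ k)) ∧ (∀ k, HasCompactSupport (χ k)) ∧ (∀ k x, |χ k x| ≤ 1) ∧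
    (∀ x, Tendsto (fun k => χ k x) atTop (𝓝 1)) ∧
    (∃ C : ℝ, 0 ≤ C ∧ ∀ k x, ‖fderiv ℝ (χ k) x‖ * ‖x‖ ≤ C) ∧
    (∀ x, Tendsto (fun k => ‖fderiv ℝ (χ k) x‖) atTop (𝓝 0)) := by
  let ψ : ContDiffBump (0 : EuclideanSpace ℝ (Fin N)) := ⟨1, 2, by norm_num, by norm_num⟩
  have hψ : ContDiff ℝ 1 ψ := ψ.contDiff
  have hdc : Continuous (fderiv ℝ ψ) := hψ.continuous_fderiv (by norm_num)
  let ε : ℕ → ℝ := fun k => 1 / ((k:ℝ) + 1)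
  have hε : ∀ k, 0 < ε k := fun k => by positivity
  have hεt : Tendsto ε atTop (𝓝 0) := tendsto_one_div_add_atTop_nhds_zero_nat
  have hεx : ∀ x : EuclideanSpace ℝ (Fin N), Tendsto (fun k => ε k • x) atTop (𝓝 0) := by
    intro x
    simpa using hεt.smul_const x
  have hfd : ∀ k x, fderiv ℝ (fun x => ψ (ε k • x)) x = ε k • fderiv ℝ ψ (ε k • x) := by
    intro k x
    exact fderiv_comp_smul (f := (ψ : EuclideanSpace ℝ (Fin N) → ℝ)) (ε k)
  refine ⟨fun k x => ψ (ε k • x), ?_, ?_, ?_, ?_, ?_, ?_⟩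
  · intro k
    exact hψ.comp (contDiff_const_smul _)
  · intro k
    exact ψ.hasCompactSupport.comp_smul (hε k).ne'
  · intro k x
    rw [abs_of_nonneg ψ.nonneg]
    exact ψ.le_one
  · intro x
    have h1 : ψ 0 = 1 := ψ.one_of_mem_closedBall (by simp [ψ])
    have := (hψ.continuous.tendsto 0).comp (hεx x)
    rw [h1] at this
    exact this
  · have hcs : HasCompactSupport (fun z : EuclideanSpace ℝ (Fin N) => ‖fderiv ℝ ψ z‖ * ‖z‖) :=
      (ψ.hasCompactSupport.fderiv ℝ).norm.mul_right
    obtain ⟨C, hC⟩ := hcs.exists_bound_of_continuous (by fun_prop)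
    refine ⟨C, (norm_nonneg _).trans (hC 0), fun k x => ?_⟩
    rw [hfd, norm_smul]
    have := hC (ε k • x)
    rw [Real.norm_eq_abs, abs_of_nonneg (by positivity), norm_smul] at this
    linarith [mul_comm ‖ε k‖ ‖fderiv ℝ ψ (ε k • x)‖,
      mul_assoc ‖fderiv ℝ ψ (ε k • x)‖ ‖ε k‖ ‖x‖, mul_right_comm ‖ε k‖ ‖fderiv ℝ ψ (ε k • x)‖ ‖x‖]
  · intro x
    simp_rw [hfd]
    have h1 := (hdc.tendsto 0).comp (hεx x)
    have h2 := (hεt.smul h1).norm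
    simpa using h2

/-- The embedding of the boundary hyperplane as a continuous linear map. -/
def bL (n : ℕ) : EuclideanSpace ℝ (Fin n) →L[ℝ] EuclideanSpace ℝ (Fin (n+1)) :=
  LinearMap.toContinuousLinearMap
    { toFun := fun y => mkPt (n+1) y 0
      map_add' := by
        intro a b
        ext i
        by_cases h : (i:ℕ) < n <;> simp [mkPt, h]
      map_smul' := by
        intro a b
        ext i
        by_cases h : (i:ℕ) < n <;> simp [mkPt, h] }

lemma bL_apply (n : ℕ) (y : EuclideanSpace ℝ (Fin n)) : bL n y = mkPt (n+1) y 0 := rfl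

lemma bL_norm (n : ℕ) (y : EuclideanSpace ℝ (Fin n)) : ‖bL n y‖ = ‖y‖ := by
  rw [bL_apply, mkPt_eq, EuclideanSpace.norm_eq, EuclideanSpace.norm_eq, Fin.sum_univ_castSucc]
  simp

lemma bL_last (n : ℕ) (y : EuclideanSpace ℝ (Fin n)) : (bL n y) (Fin.last n) = 0 := by
  rw [bL_apply, mkPt_eq]; simp

lemma contDiff_prim {f : ℝ → ℝ} (hf : Continuous f) :
    ContDiff ℝ 1 (fun t => ∫ s in (0:ℝ)..t, f s) := by
  have h : ∀ t, HasDerivAt (fun t => ∫ s in (0:ℝ)..t, f s) (f t) t := fun t =>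
    intervalIntegral.integral_hasDerivAt_right (hf.intervalIntegrable _ _)
      (hf.stronglyMeasurableAtFilter _ _) hf.continuousAt
  rw [contDiff_one_iff_deriv]
  refine ⟨fun t => (h t).differentiableAt, ?_⟩
  rw [show deriv (fun t => ∫ s in (0:ℝ)..t, f s) = f from funext fun t => (h t).deriv]
  exact hf

lemma fderiv_prim {E : Type*} [NormedAddCommGroup E] [NormedSpace ℝ E]
    {f : ℝ → ℝ} (hf : Continuous f) {u : E → ℝ} (hu : ContDiff ℝ 1 u) (x v : E) :
    fderiv ℝ (fun z => ∫ s in (0:ℝ)..(u z), f s) x v = f (u x) * fderiv ℝ u x v := by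
  have h : HasDerivAt (fun t => ∫ s in (0:ℝ)..t, f s) (f (u x)) (u x) :=
    intervalIntegral.integral_hasDerivAt_right (hf.intervalIntegrable _ _)
      (hf.stronglyMeasurableAtFilter _ _) hf.continuousAt
  have h2 := h.comp_hasFDerivAt x (hu.differentiable (by norm_num) x).hasFDerivAt
  have h3 : fderiv ℝ (fun z => ∫ s in (0:ℝ)..(u z), f s) x = f (u x) • fderiv ℝ u x := h2.fderiv
  rw [h3]; simp

lemma pohozaev_main (n : ℕ) (ρ : ℝ → ℝ) (hρC1 : ContDiff ℝ 1 ρ)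
    (hρzero : ρ 0 = 1) (c₁ : ℝ) (hc₁ : 0 < c₁)
    (hρ1 : ∀ s : ℝ, 0 < s → 0 < deriv ρ s * s ∧ deriv ρ s * s ≤ c₁ * ρ s)
    (f g : ℝ → ℝ) (hf : Continuous f) (hg : Continuous g)
    (u : EuclideanSpace ℝ (Fin (n+1)) → ℝ) (hu : ContDiff ℝ 2 u)
    (hpde : ∀ x : EuclideanSpace ℝ (Fin (n+1)), 0 < x (Fin.last n) →
      -divW (n+1) (fun z => ρ (z (Fin.last n))) u x = f (u x))
    (hbc : ∀ y : EuclideanSpace ℝ (Fin n),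
      -pd (n+1) u (Fin.last n) (bL n y) = g (u (bL n y)))
    (hint1 : IntegrableOn (fun x : EuclideanSpace ℝ (Fin (n+1)) =>
      ρ (x (Fin.last n)) * ‖gradient u x‖ ^ 2) (Hplus (n+1) (Nat.succ_pos n)) volume)
    (hint2 : IntegrableOn (fun x => ∫ s in (0 : ℝ)..(u x), f s)
      (Hplus (n+1) (Nat.succ_pos n)) volume)
    (hint3 : Integrable (fun y : EuclideanSpace ℝ (Fin n) =>
      ∫ s in (0 : ℝ)..(u (bL n y)), g s)) :
    (((n+1 : ℕ) : ℝ) - 2) / 2 *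
        (∫ x in Hplus (n+1) (Nat.succ_pos n), ρ (x (Fin.last n)) * ‖gradient u x‖ ^ 2) +
      1 / 2 * (∫ x in Hplus (n+1) (Nat.succ_pos n),
        deriv ρ (x (Fin.last n)) * x (Fin.last n) * ‖gradient u x‖ ^ 2) =
    ((n+1 : ℕ) : ℝ) * (∫ x in Hplus (n+1) (Nat.succ_pos n), ∫ s in (0 : ℝ)..(u x), f s) +
      (((n+1 : ℕ) : ℝ) - 1) * ∫ y : EuclideanSpace ℝ (Fin n),
        ∫ s in (0 : ℝ)..(u (bL n y)), g s := by
  set H := Hplus (n+1) (Nat.succ_pos n) with hH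
  have hHm : MeasurableSet H := by
    apply measurableSet_lt measurable_const
    unfold xN
    fun_prop
  have hmem : ∀ x ∈ H, 0 < x (Fin.last n) := fun x hx => hx
  have hu1 : ContDiff ℝ 1 u := hu.of_le (by norm_num)
  let w : EuclideanSpace ℝ (Fin (n+1)) → ℝ := fun z => ρ (z (Fin.last n))
  have hw : ContDiff ℝ 1 w := hρC1.comp (contDiff_coord _)
  let Φ : EuclideanSpace ℝ (Fin (n+1)) → ℝ := fun z => ∫ s in (0 : ℝ)..(u z), f s
  have hΦ : ContDiff ℝ 1 Φ := (contDiff_prim hf).comp hu1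
  let Γ₀ : EuclideanSpace ℝ (Fin (n+1)) → ℝ := fun z => ∫ s in (0 : ℝ)..(u z), g s
  have hΓ₀ : ContDiff ℝ 1 Γ₀ := (contDiff_prim hg).comp hu1
  have hwd : ∀ x : EuclideanSpace ℝ (Fin (n+1)),
      fderiv ℝ w x x = deriv ρ (x (Fin.last n)) * x (Fin.last n) := by
    intro x
    have h1 : HasFDerivAt (fun z : EuclideanSpace ℝ (Fin (n+1)) => z (Fin.last n))
      (EuclideanSpace.proj (Fin.last n) : EuclideanSpace ℝ (Fin (n+1)) →L[ℝ] ℝ) x :=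
      (EuclideanSpace.proj (Fin.last n) : EuclideanSpace ℝ (Fin (n+1)) →L[ℝ] ℝ).hasFDerivAt
    have h2 := (hρC1.differentiable (by norm_num) (x (Fin.last n))).hasDerivAt.comp_hasFDerivAt x h1
    have h3 : fderiv ℝ w x = deriv ρ (x (Fin.last n)) •
      (EuclideanSpace.proj (Fin.last n) : EuclideanSpace ℝ (Fin (n+1)) →L[ℝ] ℝ) := h2.fderiv
    rw [h3]; simp
  have hP := contDiff_pd hu
  have hgc : Continuous (fun x => gradient u x) := by
    have := hu1.continuous_fderiv (by norm_num)
    unfold gradient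
    fun_prop
  let S : EuclideanSpace ℝ (Fin (n+1)) → ℝ := fun z => ∑ j, z j * pd (n+1) u j z
  let K : EuclideanSpace ℝ (Fin (n+1)) → ℝ := fun z =>
    Φ z + (-1/2) * (w z * ∑ j, pd (n+1) u j z * pd (n+1) u j z)
  have hS : ContDiff ℝ 1 S := ContDiff.sum fun j _ => (contDiff_coord j).mul (hP j)
  have hQ : ContDiff ℝ 1 (fun z : EuclideanSpace ℝ (Fin (n+1)) =>
      ∑ j, pd (n+1) u j z * pd (n+1) u j z) :=
    ContDiff.sum fun j _ => (hP j).mul (hP j)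
  have hK : ContDiff ℝ 1 K := hΦ.add (contDiff_const.mul (hw.mul hQ))
  let V : Fin (n+1) → EuclideanSpace ℝ (Fin (n+1)) → ℝ := fun i z =>
    S z * (w z * pd (n+1) u i z) + K z * z i
  have hV : ∀ i, ContDiff ℝ 1 (V i) := fun i =>
    (hS.mul (hw.mul (hP i))).add (hK.mul (contDiff_coord i))
  let D : EuclideanSpace ℝ (Fin (n+1)) → ℝ := fun x =>
    (1 - ((n+1:ℕ):ℝ)/2) * (w x * ‖gradient u x‖ ^ 2)
      - 1/2 * (deriv ρ (x (Fin.last n)) * x (Fin.last n) * ‖gradient u x‖^2)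
      + ((n+1:ℕ):ℝ) * Φ x
  have hdiv : ∀ x ∈ H, ∑ i, pd (n+1) (V i) i x = D x := by
    intro x hx
    have := divV hu hw hΦ x (f (u x)) (fderiv_prim hf hu1 x x) (hpde x (hmem x hx))
    rw [hwd] at this
    exact this
  have hdρ : Continuous (deriv ρ) := hρC1.continuous_deriv (by norm_num)
  have hwc := hw.continuous
  have hΦc := hΦ.continuous
  have hDc : Continuous D := by
    simp only [D]
    fun_prop
  have hρpos : ∀ x ∈ H, 0 < w x := by
    intro x hx
    have := hρ1 _ (hmem x hx)
    exact pos_of_mul_pos_right (lt_of_lt_of_le this.1 this.2) hc₁.le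
  have hintB : IntegrableOn (fun x : EuclideanSpace ℝ (Fin (n+1)) =>
      deriv ρ (x (Fin.last n)) * x (Fin.last n) * ‖gradient u x‖ ^ 2) H := by
    refine Integrable.mono' (hint1.const_mul c₁) ?_ ?_
    · exact Continuous.aestronglyMeasurable (by fun_prop)
    · refine (ae_restrict_iff' hHm).2 (Eventually.of_forall fun x hx => ?_)
      have := hρ1 _ (hmem x hx)
      rw [Real.norm_eq_abs, abs_of_nonneg (mul_nonneg this.1.le (by positivity)), ← mul_assoc]
      exact mul_le_mul_of_nonneg_right this.2 (by positivity)
  have hDint : IntegrableOn D H :=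
    ((hint1.const_mul _).sub (hintB.const_mul _)).add (hint2.const_mul _)
  obtain ⟨χ, hχ1, hχc, hχb, hχt, ⟨C, hC0, hC⟩, hχd⟩ := exists_cutoff (n+1)
  have hχdc : ∀ k, Continuous (fderiv ℝ (χ k)) := fun k => (hχ1 k).continuous_fderiv (by norm_num)
  -- the integrands
  let A : ℕ → EuclideanSpace ℝ (Fin (n+1)) → ℝ := fun k x =>
    χ k x * D x + (S x * w x * fderiv ℝ (χ k) x (gradient u x) + K x * fderiv ℝ (χ k) x x)
  let B : ℕ → EuclideanSpace ℝ (Fin n) → ℝ := fun k y =>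
    (n * χ k (bL n y) + fderiv ℝ (χ k) (bL n y) (bL n y)) * Γ₀ (bL n y)
  have hAB : ∀ k, ∫ x in H, A k x = - ∫ y, B k y := by
    intro k
    have h1 := half_div n (fun i z => χ k z * V i z) (fun i => (hχ1 k).mul (hV i))
      (fun i => (hχc k).mul_right)
    have h2 : ∫ x in H, A k x = ∫ x in H, ∑ i, pd (n+1) (fun z => χ k z * V i z) i x := by
      apply setIntegral_congr_fun hHm
      intro x hx
      simp_rw [pd_mul (hχ1 k) (hV _)]
      rw [Finset.sum_add_distrib, ← Finset.mul_sum, hdiv x hx]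
      simp only [A]
      congr 1
      rw [← sum_pd, ← sum_pd, Finset.mul_sum, Finset.mul_sum, ← Finset.sum_add_distrib]
      apply Finset.sum_congr rfl
      intro i _
      rw [grad_coord]
      simp only [V]
      ring
    rw [h2, h1]
    congr 1
    -- boundary
    let h : EuclideanSpace ℝ (Fin n) → ℝ := fun y => χ k (bL n y) * Γ₀ (bL n y)
    have hh : ContDiff ℝ 1 h := ((hχ1 k).mul hΓ₀).comp (bL n).contDiff
    have hcl : Topology.IsClosedEmbedding (bL n) := by
      apply (AddMonoidHomClass.isometry_of_norm (bL n) (bL_norm n)).isClosedEmbedding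
    have hhc : HasCompactSupport h := by
      have : HasCompactSupport (fun y => χ k (bL n y)) := (hχc k).comp_isClosedEmbedding hcl
      exact this.mul_right
    have hhi : ∀ i : Fin n, ContDiff ℝ 1 (fun y : EuclideanSpace ℝ (Fin n) => h y * y i) :=
      fun i => hh.mul (contDiff_coord i)
    have hhci : ∀ i : Fin n, HasCompactSupport (fun y : EuclideanSpace ℝ (Fin n) => h y * y i) :=
      fun i => hhc.mul_right
    have hpi : ∀ i : Fin n, Integrable (fun y => pd n (fun y => h y * y i) i y) := by
      intro i
      apply Continuous.integrable_of_hasCompactSupport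
      · have := (hhi i).continuous_fderiv (by norm_num)
        unfold pd
        fun_prop
      · exact (hhci i).fderiv_apply ℝ _
    have h3 : ∫ y, ∑ i, pd n (fun y => h y * y i) i y = 0 := by
      rw [integral_finsetSum _ (fun i _ => hpi i)]
      apply Finset.sum_eq_zero
      intro i _
      exact int_fderiv_zero volume _ (hhi i) (hhci i) _
    have hBc : Integrable (B k) := by
      apply Continuous.integrable_of_hasCompactSupport
      · have := (hχ1 k).continuous
        have := hχdc k
        have := hΓ₀.continuous
        simp only [B]
        fun_prop
      · have e1 : HasCompactSupport (fun y => χ k (bL n y)) := (hχc k).comp_isClosedEmbedding hcl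
        have e2 : HasCompactSupport (fun y => fderiv ℝ (χ k) (bL n y)) :=
          ((hχc k).fderiv ℝ).comp_isClosedEmbedding hcl
        have e3 : HasCompactSupport (fun y => fderiv ℝ (χ k) (bL n y) (bL n y)) :=
          e2.mono fun y hy => by
            simp only [Function.mem_support] at hy ⊢
            intro h0; rw [h0] at hy; simp at hy
        have e4 : HasCompactSupport (fun y => (n:ℝ) * χ k (bL n y)) := e1.mul_left
        exact (e4.add e3).mul_right
    have h4 : ∀ y, χ k (mkPt (n+1) y 0) * V (Fin.last n) (mkPt (n+1) y 0) =
        B k y - ∑ i, pd n (fun y => h y * y i) i y := by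
      intro y
      rw [div_radial hh, ← bL_apply]
      have hd : fderiv ℝ h y y = χ k (bL n y) * (g (u (bL n y)) * fderiv ℝ u (bL n y) (bL n y)) +
          Γ₀ (bL n y) * fderiv ℝ (χ k) (bL n y) (bL n y) := by
        have q1 : HasFDerivAt (fun z => χ k z * Γ₀ z)
            (χ k (bL n y) • fderiv ℝ Γ₀ (bL n y) + Γ₀ (bL n y) • fderiv ℝ (χ k) (bL n y)) (bL n y) :=
          ((hχ1 k).differentiable (by norm_num) _).hasFDerivAt.mul
            (hΓ₀.differentiable (by norm_num) _).hasFDerivAt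
        have q2 := (q1.comp y (bL n).hasFDerivAt).fderiv
        have q3 : fderiv ℝ h y = (χ k (bL n y) • fderiv ℝ Γ₀ (bL n y) +
          Γ₀ (bL n y) • fderiv ℝ (χ k) (bL n y)).comp (bL n) := q2
        rw [q3]
        have q4 := fderiv_prim hg hu1 (bL n y) (bL n y)
        simp only [ContinuousLinearMap.comp_apply, ContinuousLinearMap.add_apply,
          ContinuousLinearMap.smul_apply, smul_eq_mul]
        rw [← q4]
      rw [hd]
      have hb := hbc y
      have hb' : pd (n+1) u (Fin.last n) (bL n y) = - g (u (bL n y)) := by linarith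
      simp only [V, B, h, S, w]
      rw [bL_last, hρzero, hb', sum_pd]
      ring
    simp_rw [h4]
    rw [integral_sub hBc (integrable_finsetSum _ fun i _ => hpi i), h3, sub_zero]
  have limA : Tendsto (fun k => ∫ x in H, A k x) atTop (𝓝 (∫ x in H, D x)) := by
    apply tendsto_integral_of_dominated_convergence
      (fun x => |D x| + C * (3/2 * (w x * ‖gradient u x‖^2) + |Φ x|))
    · intro k
      have := (hχ1 k).continuous
      have := hχdc k
      have := hS.continuous
      have := hK.continuous
      exact Continuous.aestronglyMeasurable (by simp only [A]; fun_prop)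
    · exact hDint.abs.add (((hint1.const_mul _).add hint2.abs).const_mul _)
    · intro k
      refine (ae_restrict_iff' hHm).2 (Eventually.of_forall fun x hx => ?_)
      have hwx := hρpos x hx
      set q := ‖gradient u x‖ with hq
      have hq0 : 0 ≤ q := norm_nonneg _
      set δ := ‖fderiv ℝ (χ k) x‖ with hδ
      have hδ0 : 0 ≤ δ := norm_nonneg _
      have hSx : |S x| ≤ q * ‖x‖ := by
        have : S x = inner ℝ (gradient u x) x := by
          simp only [S]; rw [sum_pd]; simp [gradient]
        rw [this]; exact abs_real_inner_le_norm _ _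
      have hKx : |K x| ≤ |Φ x| + 1/2 * (w x * q^2) := by
        have : K x = Φ x - 1/2 * (w x * q^2) := by
          simp only [K]; rw [hq, grad_sq]; ring
        rw [this]
        refine (abs_sub _ _).trans ?_
        rw [abs_of_nonneg (a := 1/2 * (w x * q^2)) (by positivity)]
      have h1 : |fderiv ℝ (χ k) x (gradient u x)| ≤ δ * q := (fderiv ℝ (χ k) x).le_opNorm _
      have h2 : |fderiv ℝ (χ k) x x| ≤ δ * ‖x‖ := (fderiv ℝ (χ k) x).le_opNorm _
      have h3 : |χ k x * D x| ≤ |D x| := by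
        rw [abs_mul]
        exact mul_le_of_le_one_left (abs_nonneg _) (hχb k x)
      have h4 : |S x * w x * fderiv ℝ (χ k) x (gradient u x)| ≤ (q * ‖x‖) * w x * (δ * q) := by
        rw [abs_mul, abs_mul, abs_of_pos hwx]
        gcongr
      have h5 : |K x * fderiv ℝ (χ k) x x| ≤ (|Φ x| + 1/2 * (w x * q^2)) * (δ * ‖x‖) := by
        rw [abs_mul]
        gcongr
      rw [Real.norm_eq_abs]
      refine (abs_add_le _ _).trans (add_le_add h3 ((abs_add_le _ _).trans ?_))
      calc _ ≤ (q * ‖x‖) * w x * (δ * q) + (|Φ x| + 1/2 * (w x * q^2)) * (δ * ‖x‖) :=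
            add_le_add h4 h5
        _ = (δ * ‖x‖) * (3/2 * (w x * q^2) + |Φ x|) := by ring
        _ ≤ _ := mul_le_mul_of_nonneg_right (hC k x) (by positivity)
    · refine Eventually.of_forall fun x => ?_
      have hz : ∀ v, Tendsto (fun k => fderiv ℝ (χ k) x v) atTop (𝓝 0) := by
        intro v
        have := (hχd x).mul_const ‖v‖
        rw [zero_mul] at this
        exact squeeze_zero_norm (fun k => (fderiv ℝ (χ k) x).le_opNorm v) this
      have := ((hχt x).mul_const (D x)).add
        (((hz (gradient u x)).const_mul (S x * w x)).add ((hz x).const_mul (K x)))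
      simpa using this
  have limB : Tendsto (fun k => ∫ y, B k y) atTop (𝓝 (∫ y, n * Γ₀ (bL n y))) := by
    apply tendsto_integral_of_dominated_convergence
      (fun y => (n + C) * |Γ₀ (bL n y)|)
    · intro k
      have := (hχ1 k).continuous
      have := hχdc k
      have := hΓ₀.continuous
      exact Continuous.aestronglyMeasurable (by simp only [B]; fun_prop)
    · exact hint3.abs.const_mul _
    · intro k
      refine Eventually.of_forall fun y => ?_
      rw [Real.norm_eq_abs, abs_mul]
      apply mul_le_mul_of_nonneg_right _ (abs_nonneg _)
      refine (abs_add_le _ _).trans (add_le_add ?_ ?_)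
      · rw [abs_mul, Nat.abs_cast]
        exact mul_le_of_le_one_right (by positivity) (hχb k _)
      · exact ((fderiv ℝ (χ k) (bL n y)).le_opNorm _).trans (hC k _)
    · refine Eventually.of_forall fun y => ?_
      have hz : Tendsto (fun k => fderiv ℝ (χ k) (bL n y) (bL n y)) atTop (𝓝 0) := by
        have := (hχd (bL n y)).mul_const ‖bL n y‖
        rw [zero_mul] at this
        exact squeeze_zero_norm (fun k => (fderiv ℝ (χ k) (bL n y)).le_opNorm _) this
      have := (((hχt (bL n y)).const_mul (n:ℝ)).add hz).mul_const (Γ₀ (bL n y))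
      simpa using this
  have hfin : ∫ x in H, D x = - ∫ y, n * Γ₀ (bL n y) := by
    refine tendsto_nhds_unique limA ?_
    simp_rw [hAB]
    exact limB.neg
  have hDI : ∫ x in H, D x =
      (1 - ((n+1:ℕ):ℝ)/2) * (∫ x in H, ρ (x (Fin.last n)) * ‖gradient u x‖ ^ 2)
      - 1/2 * (∫ x in H, deriv ρ (x (Fin.last n)) * x (Fin.last n) * ‖gradient u x‖^2)
      + ((n+1:ℕ):ℝ) * ∫ x in H, ∫ s in (0 : ℝ)..(u x), f s := by
    rw [← integral_const_mul, ← integral_const_mul, ← integral_const_mul,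
      ← integral_sub (hint1.const_mul _) (hintB.const_mul _)]
    exact integral_add ((hint1.const_mul _).sub (hintB.const_mul _)) (hint2.const_mul _)
  rw [hDI, integral_const_mul] at hfin
  change _ = -((n:ℝ) * ∫ y : EuclideanSpace ℝ (Fin n), ∫ s in (0 : ℝ)..(u (bL n y)), g s) at hfin
  push_cast at hfin ⊢
  linarith

theorem stmt10 (N : ℕ) (hN : 3 ≤ N) (ρ : ℝ → ℝ) (hρC1 : ContDiff ℝ 1 ρ)
    (hρzero : ρ 0 = 1) (c₁ : ℝ) (hc₁ : 0 < c₁)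
    (hρ1 : ∀ s : ℝ, 0 < s → 0 < deriv ρ s * s ∧ deriv ρ s * s ≤ c₁ * ρ s)
    (f g : ℝ → ℝ) (hf : Continuous f) (hg : Continuous g)
    (u : EuclideanSpace ℝ (Fin N) → ℝ) (hu : ContDiff ℝ 2 u)
    (hpde : ∀ x, 0 < xN N (by omega) x →
      -divW N (fun z => ρ (xN N (by omega) z)) u x = f (u x))
    (hbc : ∀ y : EuclideanSpace ℝ (Fin (N - 1)),
      -pd N u ⟨N - 1, by omega⟩ (bPt N y) = g (u (bPt N y)))
    (hint1 : IntegrableOn (fun x => ρ (xN N (by omega) x) * ‖gradient u x‖ ^ 2)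
      (Hplus N (by omega)) volume)
    (hint2 : IntegrableOn (fun x => ∫ s in (0 : ℝ)..(u x), f s)
      (Hplus N (by omega)) volume)
    (hint3 : Integrable (fun y : EuclideanSpace ℝ (Fin (N - 1)) =>
      ∫ s in (0 : ℝ)..(u (bPt N y)), g s)) :
    ((N : ℝ) - 2) / 2 *
        (∫ x in Hplus N (by omega), ρ (xN N (by omega) x) * ‖gradient u x‖ ^ 2) +
      1 / 2 * (∫ x in Hplus N (by omega),
        deriv ρ (xN N (by omega) x) * xN N (by omega) x * ‖gradient u x‖ ^ 2) =
    (N : ℝ) * (∫ x in Hplus N (by omega), ∫ s in (0 : ℝ)..(u x), f s) +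
      ((N : ℝ) - 1) * ∫ y : EuclideanSpace ℝ (Fin (N - 1)),
        ∫ s in (0 : ℝ)..(u (bPt N y)), g s := by
  obtain ⟨n, rfl⟩ : ∃ n, N = n + 1 := ⟨N - 1, by omega⟩
  exact pohozaev_main n ρ hρC1 hρzero c₁ hc₁ hρ1 f g hf hg u hu hpde hbc hint1 hint2 hint3
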